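/- The slash rule defines a right action of G̃ on functions on the double half-plane: for every f : ℍ* → ℂ and all [α,ε], [β,δ] ∈ G̃ one has (f|[α,ε])|[β,δ] = f|[αβ, A(α,β)·ε·δ]; moreover f|[I,1] = f, and if f is holomorphic on ℍ* then so is f|[γ,ε] for every [γ,ε] ∈ G̃. -/

import Mathlib

open Matrix

noncomputable section

abbrev GL2Z := GL (Fin 2) ℤ

/-- The Hilbert symbol at the infinite place of `ℚ`:
`(a,b) = -1` if `a < 0` and `b < 0`, and `(a,b) = 1` otherwise. -/
def hilb (a b : ℚ) : ℤˣ := if a < 0 ∧ b < 0 then -1 else 1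

/-- Kubota's function `χ`: for `γ = [[a,b],[c,d]]`, `χ(γ) = c` if `c ≠ 0`, else `χ(γ) = d`. -/
def chi (γ : GL2Z) : ℤ :=
  if (γ : Matrix (Fin 2) (Fin 2) ℤ) 1 0 = 0 then (γ : Matrix (Fin 2) (Fin 2) ℤ) 1 1
  else (γ : Matrix (Fin 2) (Fin 2) ℤ) 1 0

/-- The determinant of an element of `GL₂(ℤ)`, as an integer. -/
def detZ (γ : GL2Z) : ℤ := ((γ : Matrix (Fin 2) (Fin 2) ℤ)).det

/-- Kubota's twisted 2-cocycle
`A(α,β) = (det α, det β)·(χ(αβ)/χ(α), χ(αβ)/(χ(β)·det α))`. -/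
def KA (α β : GL2Z) : ℤˣ :=
  hilb (detZ α) (detZ β) *
    hilb ((chi (α * β) : ℚ) / (chi α : ℚ))
      ((chi (α * β) : ℚ) / ((chi β : ℚ) * (detZ α : ℚ)))

/-- The matrix `R = [[-1,0],[0,1]]` as an element of `GL₂(ℤ)`. -/
def Rm : GL2Z :=
  ⟨!![-1, 0; 0, 1], !![-1, 0; 0, 1],
    by rw [Matrix.mul_fin_two, Matrix.one_fin_two]; norm_num,
    by rw [Matrix.mul_fin_two, Matrix.one_fin_two]; norm_num⟩

/-- `B(γ) = (χ(γ), χ(γR))`. -/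
def KB (γ : GL2Z) : ℤˣ := hilb (chi γ) (chi (γ * Rm))

/-- The upper half-plane `ℍ⁺` as a subset of `ℂ`. -/
def Hplus : Set ℂ := {z : ℂ | 0 < z.im}

/-- The double half-plane `ℍ* = ℍ⁺ ∪ ℍ⁻` as a subset of `ℂ`. -/
def Hstar : Set ℂ := {z : ℂ | z.im ≠ 0}

/-- The Möbius action `γ·z = (az+b)/(cz+d)` of `GL₂(ℤ)` on the double half-plane. -/
def mact (γ : GL2Z) (z : ℂ) : ℂ :=
  (((γ : Matrix (Fin 2) (Fin 2) ℤ) 0 0 : ℂ) * z + ((γ : Matrix (Fin 2) (Fin 2) ℤ) 0 1 : ℂ)) /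
    (((γ : Matrix (Fin 2) (Fin 2) ℤ) 1 0 : ℂ) * z + ((γ : Matrix (Fin 2) (Fin 2) ℤ) 1 1 : ℂ))

/-- `φ` is a metaplectic section: a family `(φ_γ)_{γ ∈ SL₂(ℤ)}` of holomorphic functions
on `ℍ⁺` with `φ_γ(z)² = cz + d` whenever `γ` has bottom row `(c,d)`, and
`φ_α(β·z)·φ_β(z) = A(α,β)·φ_{αβ}(z)` for all `α, β ∈ SL₂(ℤ)` and `z ∈ ℍ⁺`. -/
def IsMetaplecticSection (φ : GL2Z → ℂ → ℂ) : Prop :=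
  (∀ γ : GL2Z, detZ γ = 1 → DifferentiableOn ℂ (φ γ) Hplus) ∧
  (∀ γ : GL2Z, detZ γ = 1 → ∀ z ∈ Hplus,
    (φ γ z) ^ 2 = ((γ : Matrix (Fin 2) (Fin 2) ℤ) 1 0 : ℂ) * z +
      ((γ : Matrix (Fin 2) (Fin 2) ℤ) 1 1 : ℂ)) ∧
  (∀ α β : GL2Z, detZ α = 1 → detZ β = 1 → ∀ z ∈ Hplus,
    φ α (mact β z) * φ β z = ((KA α β : ℤ) : ℂ) * φ (α * β) z)

/-- The automorphy factor of the weight-`w/2` slash action of `G̃` on functions on the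
double half-plane (`w` is twice the weight), relative to a metaplectic section `φ`. -/
def slashFactor (w : ℤ) (φ : GL2Z → ℂ → ℂ) (γ : GL2Z) (ε : ℤˣ) (z : ℂ) : ℂ :=
  if 0 < z.im then
    if detZ γ = 1 then (((ε : ℤ) : ℂ) * φ γ z) ^ (-w)
    else (Complex.I * ((ε : ℤ) : ℂ) * ((KA Rm γ : ℤ) : ℂ) * φ (Rm * γ) z) ^ (-w)
  else
    if detZ γ = 1 then (((ε : ℤ) : ℂ) * ((KB γ : ℤ) : ℂ) * φ (Rm * γ * Rm) (-z)) ^ (-w)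
    else (Complex.I * ((ε : ℤ) : ℂ) * ((KA Rm γ : ℤ) : ℂ) * ((KB (Rm * γ) : ℤ) : ℂ) *
      φ (γ * Rm) (-z)) ^ (-w)

/-- The weight-`w/2` slash action `f ↦ f|[γ,ε]` of `G̃` on functions on the double
half-plane. -/
def slash (w : ℤ) (φ : GL2Z → ℂ → ℂ) (f : ℂ → ℂ) (γ : GL2Z) (ε : ℤˣ) : ℂ → ℂ :=
  fun z => f (mact γ z) * slashFactor w φ γ ε z

/-! ### Sign data of an integral matrix -/

/-- The sign `±1` attached to a Boolean, `true` being `-1`. -/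
def boolSign (b : Bool) : ℤˣ := if b then -1 else 1

/-- Whether `χ(γ)` is negative. -/
def chiNeg (γ : GL2Z) : Bool := decide (chi γ < 0)

/-- Whether the determinant is negative. -/
def detNeg (γ : GL2Z) : Bool := decide (detZ γ < 0)

/-- Whether the lower left entry vanishes. -/
def lowerLeftZero (γ : GL2Z) : Bool :=
  decide ((γ : Matrix (Fin 2) (Fin 2) ℤ) 1 0 = 0)

lemma boolSign_mul (a b : Bool) : boolSign a * boolSign b = boolSign (a ^^ b) := by
  cases a <;> cases b <;> simp [boolSign]

lemma detZ_eq_one_or (γ : GL2Z) : detZ γ = 1 ∨ detZ γ = -1 := by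
  have h : IsUnit (detZ γ) := (Matrix.isUnit_iff_isUnit_det _).1 γ.isUnit
  exact Int.isUnit_iff.1 h

lemma detZ_mul (α β : GL2Z) : detZ (α * β) = detZ α * detZ β := by
  simp [detZ]

lemma detZ_eq (γ : GL2Z) : detZ γ =
    (γ : Matrix (Fin 2) (Fin 2) ℤ) 0 0 * (γ : Matrix (Fin 2) (Fin 2) ℤ) 1 1 -
      (γ : Matrix (Fin 2) (Fin 2) ℤ) 0 1 * (γ : Matrix (Fin 2) (Fin 2) ℤ) 1 0 :=
  Matrix.det_fin_two _

lemma detZ_one : detZ 1 = 1 := by simp [detZ]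

lemma detZ_Rm : detZ Rm = -1 := by simp [detZ, Rm, Matrix.det_fin_two]

lemma Rm_mul_Rm : Rm * Rm = 1 := by
  ext i j
  fin_cases i <;> fin_cases j <;> simp [Rm, Matrix.mul_apply]

lemma Rm_mul_Rm_mul (γ : GL2Z) : Rm * (Rm * γ) = γ := by
  rw [← mul_assoc, Rm_mul_Rm, one_mul]

lemma mul_apply_fin_two (α β : GL2Z) (i j : Fin 2) :
    ((α * β : GL2Z) : Matrix (Fin 2) (Fin 2) ℤ) i j =
      (α : Matrix (Fin 2) (Fin 2) ℤ) i 0 * (β : Matrix (Fin 2) (Fin 2) ℤ) 0 j +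
      (α : Matrix (Fin 2) (Fin 2) ℤ) i 1 * (β : Matrix (Fin 2) (Fin 2) ℤ) 1 j := by
  simp [Matrix.mul_apply]

lemma bottom_row_ne_zero (γ : GL2Z) :
    (γ : Matrix (Fin 2) (Fin 2) ℤ) 1 0 ≠ 0 ∨ (γ : Matrix (Fin 2) (Fin 2) ℤ) 1 1 ≠ 0 := by
  by_contra! h
  have := detZ_eq γ
  rw [h.1, h.2] at this
  rcases detZ_eq_one_or γ with h | h <;> omega

lemma chi_ne_zero (γ : GL2Z) : chi γ ≠ 0 := by
  have := bottom_row_ne_zero γ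
  unfold chi
  split_ifs <;> tauto

lemma detZ_ne_zero (γ : GL2Z) : detZ γ ≠ 0 := by
  rcases detZ_eq_one_or γ with h | h <;> omega

lemma hilb_eq (a b : ℚ) : hilb a b = boolSign (decide (a < 0) && decide (b < 0)) := by
  simp [hilb, boolSign]

lemma decide_mul_neg {a b : ℚ} (ha : a ≠ 0) (hb : b ≠ 0) :
    decide (a * b < 0) = (decide (a < 0) ^^ decide (b < 0)) := by
  rcases ha.lt_or_gt with ha | ha <;> rcases hb.lt_or_gt with hb | hb <;>
    simp [ha, hb, mul_neg_iff, ha.not_gt, hb.not_gt]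

lemma decide_mul_neg_int {a b : ℤ} (ha : a ≠ 0) (hb : b ≠ 0) :
    decide (a * b < 0) = (decide (a < 0) ^^ decide (b < 0)) := by
  have := decide_mul_neg (a := a) (b := b) (by exact_mod_cast ha) (by exact_mod_cast hb)
  exact_mod_cast this

lemma decide_div_neg {a b : ℚ} (ha : a ≠ 0) (hb : b ≠ 0) :
    decide (a / b < 0) = (decide (a < 0) ^^ decide (b < 0)) := by
  rw [div_eq_mul_inv, decide_mul_neg ha (inv_ne_zero hb)]
  simp

lemma KA_eq (α β : GL2Z) : KA α β = boolSign ((detNeg α && detNeg β) ^^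
    ((chiNeg (α * β) ^^ chiNeg α) && (chiNeg (α * β) ^^ (chiNeg β ^^ detNeg α)))) := by
  have h (γ : GL2Z) : (chi γ : ℚ) ≠ 0 := by exact_mod_cast chi_ne_zero γ
  have hd : (detZ α : ℚ) ≠ 0 := by exact_mod_cast detZ_ne_zero α
  rw [KA, hilb_eq, hilb_eq, decide_div_neg (h _) (h _),
    decide_div_neg (h _) (mul_ne_zero (h _) hd), decide_mul_neg (h _) hd, boolSign_mul]
  simp [chiNeg, detNeg]

lemma KB_eq (γ : GL2Z) : KB γ = boolSign (chiNeg γ && chiNeg (γ * Rm)) := by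
  rw [KB, hilb_eq]
  simp [chiNeg]

lemma detNeg_mul (α β : GL2Z) : detNeg (α * β) = (detNeg α ^^ detNeg β) := by
  rw [detNeg, detZ_mul, decide_mul_neg_int (detZ_ne_zero _) (detZ_ne_zero _)]
  rfl

lemma detNeg_Rm : detNeg Rm = true := by simp [detNeg, detZ_Rm]

lemma chiNeg_Rm : chiNeg Rm = false := by simp [chiNeg, chi, Rm]

lemma chi_Rm_mul (γ : GL2Z) : chi (Rm * γ) = chi γ := by
  simp only [chi, mul_apply_fin_two]
  simp [Rm]

lemma chiNeg_Rm_mul (γ : GL2Z) : chiNeg (Rm * γ) = chiNeg γ := by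
  rw [chiNeg, chi_Rm_mul, chiNeg]

lemma lowerLeftZero_Rm_mul (γ : GL2Z) : lowerLeftZero (Rm * γ) = lowerLeftZero γ := by
  simp only [lowerLeftZero, mul_apply_fin_two]
  simp [Rm]

lemma chiNeg_mul_Rm (γ : GL2Z) : chiNeg (γ * Rm) = (chiNeg γ ^^ !lowerLeftZero γ) := by
  have := chi_ne_zero γ
  simp only [chiNeg, chi, lowerLeftZero, mul_apply_fin_two] at this ⊢
  by_cases h : (γ : Matrix (Fin 2) (Fin 2) ℤ) 1 0 = 0
  · simp [Rm, h]
  · rw [if_neg h] at this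
    rcases this.lt_or_gt with h' | h' <;> simp [Rm, h, h', h'.not_gt]

/-- The sign of `χ(αβ)` when the lower left entry of `α` vanishes. -/
lemma chiNeg_mul_of_left (α β : GL2Z) (h : lowerLeftZero α = true) :
    chiNeg (α * β) = (chiNeg α ^^ chiNeg β) ∧ lowerLeftZero (α * β) = lowerLeftZero β := by
  have hα : (α : Matrix (Fin 2) (Fin 2) ℤ) 1 0 = 0 := by simpa [lowerLeftZero] using h
  have hd := (bottom_row_ne_zero α).resolve_left (not_not.2 hα)
  have key : chi (α * β) = chi α * chi β := by
    simp only [chi, mul_apply_fin_two]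
    simp [hα, hd]
  refine ⟨?_, ?_⟩
  · rw [chiNeg, key, decide_mul_neg_int (chi_ne_zero _) (chi_ne_zero _)]
    rfl
  · simp only [lowerLeftZero, mul_apply_fin_two]
    simp [hα, hd]

/-- The sign of `χ(αβ)` when the lower left entry of `β` vanishes and that of `α` does not. -/
lemma chiNeg_mul_of_right (α β : GL2Z) (hα : lowerLeftZero α = false)
    (hβ : lowerLeftZero β = true) :
    chiNeg (α * β) = (chiNeg α ^^ (chiNeg β ^^ detNeg β)) ∧ lowerLeftZero (α * β) = false := by
  replace hα : (α : Matrix (Fin 2) (Fin 2) ℤ) 1 0 ≠ 0 := by simpa [lowerLeftZero] using hα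
  replace hβ : (β : Matrix (Fin 2) (Fin 2) ℤ) 1 0 = 0 := by simpa [lowerLeftZero] using hβ
  have hdet := detZ_eq β
  rw [hβ, mul_zero, sub_zero] at hdet
  have ha : (β : Matrix (Fin 2) (Fin 2) ℤ) 0 0 ≠ 0 := by
    rintro h
    exact detZ_ne_zero β (by rw [hdet, h, zero_mul])
  have key : chi (α * β) * (chi β * chi β) = chi α * (chi β * detZ β) := by
    simp only [chi, mul_apply_fin_two, hdet]
    simp [hα, hβ, ha]
    ring
  have hs := congrArg (fun n : ℤ => decide (n < 0)) key
  have hc := chi_ne_zero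
  have hD := detZ_ne_zero β
  rw [decide_mul_neg_int (hc _) (mul_ne_zero (hc _) (hc _)),
    decide_mul_neg_int (hc _) (mul_ne_zero (hc _) hD), decide_mul_neg_int (hc _) (hc _),
    decide_mul_neg_int (hc _) hD] at hs
  refine ⟨by simpa [chiNeg, detNeg] using hs, ?_⟩
  simp only [lowerLeftZero, mul_apply_fin_two]
  simp [hα, hβ, ha]

/-- The sign of `χ(αβ)` when the lower left entry of `αβ` vanishes, but those of `α` and `β`
do not. -/
lemma chiNeg_mul_of_mul (α β : GL2Z) (hα : lowerLeftZero α = false)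
    (hβ : lowerLeftZero β = false) (hαβ : lowerLeftZero (α * β) = true) :
    chiNeg (α * β) = !(chiNeg α ^^ (chiNeg β ^^ detNeg β)) := by
  replace hα : (α : Matrix (Fin 2) (Fin 2) ℤ) 1 0 ≠ 0 := by simpa [lowerLeftZero] using hα
  replace hβ : (β : Matrix (Fin 2) (Fin 2) ℤ) 1 0 ≠ 0 := by simpa [lowerLeftZero] using hβ
  replace hαβ : ((α * β : GL2Z) : Matrix (Fin 2) (Fin 2) ℤ) 1 0 = 0 := by
    simpa [lowerLeftZero] using hαβ
  have key : chi β * chi (α * β) = (-1) * (chi α * detZ β) := by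
    simp only [chi, if_neg hα, if_neg hβ, if_pos hαβ, detZ_eq]
    rw [mul_apply_fin_two] at hαβ ⊢
    linear_combination (β : Matrix (Fin 2) (Fin 2) ℤ) 1 1 * hαβ
  have hs := congrArg (fun n : ℤ => decide (n < 0)) key
  have hc := chi_ne_zero
  have hD := detZ_ne_zero β
  rw [decide_mul_neg_int (hc _) (hc _),
    decide_mul_neg_int (by norm_num) (mul_ne_zero (hc _) hD),
    decide_mul_neg_int (hc _) hD] at hs
  change (chiNeg β ^^ chiNeg (α * β)) = (_ ^^ (chiNeg α ^^ detNeg β)) at hs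
  revert hs
  generalize chiNeg (α * β) = a
  generalize chiNeg α = b
  generalize chiNeg β = c
  generalize detNeg β = d
  revert a b c d
  decide

/-! ### The Möbius action on the double half-plane -/

lemma denom_ne_zero (γ : GL2Z) {z : ℂ} (hz : z.im ≠ 0) :
    ((γ : Matrix (Fin 2) (Fin 2) ℤ) 1 0 : ℂ) * z +
      ((γ : Matrix (Fin 2) (Fin 2) ℤ) 1 1 : ℂ) ≠ 0 := by
  intro h
  have him := congrArg Complex.im h
  have hre := congrArg Complex.re h
  simp [hz] at him hre
  simp [him] at hre
  have := bottom_row_ne_zero γ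
  tauto

lemma mact_mul (α β : GL2Z) {z : ℂ} (hz : z.im ≠ 0) :
    mact (α * β) z = mact α (mact β z) := by
  have h1 := denom_ne_zero β hz
  have h2 := denom_ne_zero (α * β) hz
  simp only [mact, mul_apply_fin_two] at h2 ⊢
  push_cast at h2 ⊢
  rw [mul_div_assoc', mul_div_assoc', div_add' _ _ _ h1, div_add' _ _ _ h1,
    div_div_div_cancel_right₀ h1]
  congr 1 <;> ring

lemma mact_one (z : ℂ) : mact 1 z = z := by simp [mact]

lemma mact_Rm (z : ℂ) : mact Rm z = -z := by simp [mact, Rm]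

lemma mact_im (γ : GL2Z) (z : ℂ) : (mact γ z).im = detZ γ * z.im /
    Complex.normSq (((γ : Matrix (Fin 2) (Fin 2) ℤ) 1 0 : ℂ) * z +
      ((γ : Matrix (Fin 2) (Fin 2) ℤ) 1 1 : ℂ)) := by
  rw [mact, Complex.div_im, ← sub_div, detZ_eq]
  congr 1
  simp
  ring

lemma normSq_denom_pos (γ : GL2Z) {z : ℂ} (hz : z.im ≠ 0) :
    0 < Complex.normSq (((γ : Matrix (Fin 2) (Fin 2) ℤ) 1 0 : ℂ) * z +
      ((γ : Matrix (Fin 2) (Fin 2) ℤ) 1 1 : ℂ)) :=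
  Complex.normSq_pos.2 (denom_ne_zero γ hz)

lemma mact_im_pos_iff (γ : GL2Z) {z : ℂ} (hz : z.im ≠ 0) :
    0 < (mact γ z).im ↔ 0 < (detZ γ : ℝ) * z.im := by
  rw [mact_im, div_pos_iff_of_pos_right (normSq_denom_pos γ hz)]

lemma mact_im_ne_zero (γ : GL2Z) {z : ℂ} (hz : z.im ≠ 0) : (mact γ z).im ≠ 0 := by
  rw [mact_im]
  exact div_ne_zero (mul_ne_zero (by exact_mod_cast detZ_ne_zero γ) hz)
    (normSq_denom_pos γ hz).ne'

lemma differentiableAt_mact (γ : GL2Z) {z : ℂ} (hz : z.im ≠ 0) :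
    DifferentiableAt ℂ (mact γ) z := by
  unfold mact
  exact DifferentiableAt.div (by fun_prop) (by fun_prop) (denom_ne_zero γ hz)

/-! ### The automorphy factor of weight one half -/

/-- The automorphy factor of weight one half, without the central sign. -/
def halfFactor (φ : GL2Z → ℂ → ℂ) (γ : GL2Z) (z : ℂ) : ℂ :=
  if 0 < z.im then
    if detZ γ = 1 then φ γ z
    else Complex.I * ((KA Rm γ : ℤ) : ℂ) * φ (Rm * γ) z
  else
    if detZ γ = 1 then ((KB γ : ℤ) : ℂ) * φ (Rm * γ * Rm) (-z)
    else Complex.I * ((KA Rm γ : ℤ) : ℂ) * ((KB (Rm * γ) : ℤ) : ℂ) * φ (γ * Rm) (-z)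

lemma slashFactor_eq (w : ℤ) (φ : GL2Z → ℂ → ℂ) (γ : GL2Z) (ε : ℤˣ) (z : ℂ) :
    slashFactor w φ γ ε z = (((ε : ℤ) : ℂ) * halfFactor φ γ z) ^ (-w) := by
  unfold slashFactor halfFactor
  split_ifs <;> congr 1 <;> ring

/-- The cocycle relation of a metaplectic section at a product of two elements. -/
lemma IsMetaplecticSection.mul {φ : GL2Z → ℂ → ℂ} (hφ : IsMetaplecticSection φ) {α β γ : GL2Z}
    {z z' : ℂ} (hα : detZ α = 1) (hβ : detZ β = 1) (hz : 0 < z.im) (hz' : mact β z = z')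
    (hγ : α * β = γ) : φ α z' * φ β z = ((KA α β : ℤ) : ℂ) * φ γ z := by
  rw [← hz', ← hγ]
  exact hφ.2.2 α β hα hβ z hz

/-- The possible sign data of two matrices and their product. -/
lemma signs_mul (α β : GL2Z) :
    (lowerLeftZero α = true → chiNeg (α * β) = (chiNeg α ^^ chiNeg β) ∧
      lowerLeftZero (α * β) = lowerLeftZero β) ∧
    (lowerLeftZero α = false → lowerLeftZero β = true →
      chiNeg (α * β) = (chiNeg α ^^ (chiNeg β ^^ detNeg β)) ∧ lowerLeftZero (α * β) = false) ∧
    (lowerLeftZero α = false → lowerLeftZero β = false → lowerLeftZero (α * β) = true →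
      chiNeg (α * β) = !(chiNeg α ^^ (chiNeg β ^^ detNeg β))) :=
  ⟨chiNeg_mul_of_left α β, chiNeg_mul_of_right α β, chiNeg_mul_of_mul α β⟩

lemma chiNeg_mul_mul_Rm (α β : GL2Z) :
    chiNeg (α * (β * Rm)) = (chiNeg (α * β) ^^ !lowerLeftZero (α * β)) := by
  rw [← mul_assoc, chiNeg_mul_Rm]

/-! ### Sign identities behind the cocycle relation

In the names, the first two signs are those of the determinants, and the last word is the half-plane
containing the argument. -/

section SignIdentities

set_option linter.unusedSimpArgs false

lemma KA_signs_neg_pos_upper {α β : GL2Z} (hα : detNeg α = true) (hβ : detNeg β = false) :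
    KA Rm α * KA (Rm * α) β =
      KA α β * KA Rm (α * β) := by
  have h := signs_mul α β
  simp only [hα, hβ, KA_eq, KB_eq, boolSign_mul, mul_assoc, Rm_mul_Rm_mul, detNeg_mul,
    detNeg_Rm, chiNeg_Rm, chiNeg_Rm_mul, chiNeg_mul_Rm, chiNeg_mul_mul_Rm,
    lowerLeftZero_Rm_mul] at h ⊢
  revert h
  generalize chiNeg (α * β) = a, chiNeg α = b, chiNeg β = c, lowerLeftZero (α * β) = k,
    lowerLeftZero α = l, lowerLeftZero β = m
  revert a b c k l m
  decide

lemma KA_signs_pos_neg_upper {α β : GL2Z} (hα : detNeg α = false) (hβ : detNeg β = true) :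
    KB α * KA Rm β * KA (Rm * α * Rm) (Rm * β) =
      KA α β * KA Rm (α * β) := by
  have h := signs_mul α β
  simp only [hα, hβ, KA_eq, KB_eq, boolSign_mul, mul_assoc, Rm_mul_Rm_mul, detNeg_mul,
    detNeg_Rm, chiNeg_Rm, chiNeg_Rm_mul, chiNeg_mul_Rm, chiNeg_mul_mul_Rm,
    lowerLeftZero_Rm_mul] at h ⊢
  revert h
  generalize chiNeg (α * β) = a, chiNeg α = b, chiNeg β = c, lowerLeftZero (α * β) = k,
    lowerLeftZero α = l, lowerLeftZero β = m
  revert a b c k l m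
  decide

lemma KA_signs_neg_neg_upper {α β : GL2Z} (hα : detNeg α = true) (hβ : detNeg β = true) :
    boolSign true * KA Rm α * KB (Rm * α) * KA Rm β * KA (α * Rm) (Rm * β) =
      KA α β := by
  have h := signs_mul α β
  simp only [hα, hβ, KA_eq, KB_eq, boolSign_mul, mul_assoc, Rm_mul_Rm_mul, detNeg_mul,
    detNeg_Rm, chiNeg_Rm, chiNeg_Rm_mul, chiNeg_mul_Rm, chiNeg_mul_mul_Rm,
    lowerLeftZero_Rm_mul] at h ⊢
  revert h
  generalize chiNeg (α * β) = a, chiNeg α = b, chiNeg β = c, lowerLeftZero (α * β) = k,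
    lowerLeftZero α = l, lowerLeftZero β = m
  revert a b c k l m
  decide

lemma KA_signs_pos_pos_lower {α β : GL2Z} (hα : detNeg α = false) (hβ : detNeg β = false) :
    KB α * KB β * KA (Rm * α * Rm) (Rm * β * Rm) =
      KA α β * KB (α * β) := by
  have h := signs_mul α β
  simp only [hα, hβ, KA_eq, KB_eq, boolSign_mul, mul_assoc, Rm_mul_Rm_mul, detNeg_mul,
    detNeg_Rm, chiNeg_Rm, chiNeg_Rm_mul, chiNeg_mul_Rm, chiNeg_mul_mul_Rm,
    lowerLeftZero_Rm_mul] at h ⊢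
  revert h
  generalize chiNeg (α * β) = a, chiNeg α = b, chiNeg β = c, lowerLeftZero (α * β) = k,
    lowerLeftZero α = l, lowerLeftZero β = m
  revert a b c k l m
  decide

lemma KA_signs_neg_pos_lower {α β : GL2Z} (hα : detNeg α = true) (hβ : detNeg β = false) :
    KA Rm α * KB (Rm * α) * KB β * KA (α * Rm) (Rm * β * Rm) =
      KA α β * KA Rm (α * β) * KB (Rm * (α * β)) := by
  have h := signs_mul α β
  simp only [hα, hβ, KA_eq, KB_eq, boolSign_mul, mul_assoc, Rm_mul_Rm_mul, detNeg_mul,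
    detNeg_Rm, chiNeg_Rm, chiNeg_Rm_mul, chiNeg_mul_Rm, chiNeg_mul_mul_Rm,
    lowerLeftZero_Rm_mul] at h ⊢
  revert h
  generalize chiNeg (α * β) = a, chiNeg α = b, chiNeg β = c, lowerLeftZero (α * β) = k,
    lowerLeftZero α = l, lowerLeftZero β = m
  revert a b c k l m
  decide

lemma KA_signs_pos_neg_lower {α β : GL2Z} (hα : detNeg α = false) (hβ : detNeg β = true) :
    KA Rm β * KB (Rm * β) * KA α (β * Rm) =
      KA α β * KA Rm (α * β) * KB (Rm * (α * β)) := by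
  have h := signs_mul α β
  simp only [hα, hβ, KA_eq, KB_eq, boolSign_mul, mul_assoc, Rm_mul_Rm_mul, detNeg_mul,
    detNeg_Rm, chiNeg_Rm, chiNeg_Rm_mul, chiNeg_mul_Rm, chiNeg_mul_mul_Rm,
    lowerLeftZero_Rm_mul] at h ⊢
  revert h
  generalize chiNeg (α * β) = a, chiNeg α = b, chiNeg β = c, lowerLeftZero (α * β) = k,
    lowerLeftZero α = l, lowerLeftZero β = m
  revert a b c k l m
  decide

lemma KA_signs_neg_neg_lower {α β : GL2Z} (hα : detNeg α = true) (hβ : detNeg β = true) :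
    boolSign true * KA Rm α * KA Rm β * KB (Rm * β) * KA (Rm * α) (β * Rm) =
      KA α β * KB (α * β) := by
  have h := signs_mul α β
  simp only [hα, hβ, KA_eq, KB_eq, boolSign_mul, mul_assoc, Rm_mul_Rm_mul, detNeg_mul,
    detNeg_Rm, chiNeg_Rm, chiNeg_Rm_mul, chiNeg_mul_Rm, chiNeg_mul_mul_Rm,
    lowerLeftZero_Rm_mul] at h ⊢
  revert h
  generalize chiNeg (α * β) = a, chiNeg α = b, chiNeg β = c, lowerLeftZero (α * β) = k,
    lowerLeftZero α = l, lowerLeftZero β = m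
  revert a b c k l m
  decide

end SignIdentities

/-! ### The cocycle relation on the double half-plane -/

lemma detNeg_eq_false {γ : GL2Z} (h : detZ γ = 1) : detNeg γ = false := by simp [detNeg, h]

lemma detNeg_eq_true {γ : GL2Z} (h : detZ γ = -1) : detNeg γ = true := by simp [detNeg, h]

lemma mact_mul_Rm_neg (γ : GL2Z) {z : ℂ} (hz : z.im ≠ 0) : mact (γ * Rm) (-z) = mact γ z := by
  rw [mact_mul _ _ (by simpa using hz), mact_Rm, neg_neg]

lemma mact_Rm_mul (γ : GL2Z) {z : ℂ} (hz : z.im ≠ 0) : mact (Rm * γ) z = -mact γ z := by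
  rw [mact_mul _ _ hz, mact_Rm]

lemma mact_Rm_mul_mul_Rm_neg (γ : GL2Z) {z : ℂ} (hz : z.im ≠ 0) :
    mact (Rm * γ * Rm) (-z) = -mact γ z := by
  rw [mact_mul_Rm_neg _ hz, mact_Rm_mul _ hz]

section Values

variable {φ : GL2Z → ℂ → ℂ} {γ : GL2Z} {z : ℂ}

lemma halfFactor_pos_upper (h : detZ γ = 1) (hz : 0 < z.im) : halfFactor φ γ z = φ γ z := by
  simp [halfFactor, h, hz]

lemma halfFactor_neg_upper (h : detZ γ = -1) (hz : 0 < z.im) :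
    halfFactor φ γ z = Complex.I * ((KA Rm γ : ℤ) : ℂ) * φ (Rm * γ) z := by
  simp [halfFactor, h, hz]

lemma halfFactor_pos_lower (h : detZ γ = 1) (hz : z.im < 0) :
    halfFactor φ γ z = ((KB γ : ℤ) : ℂ) * φ (Rm * γ * Rm) (-z) := by
  simp [halfFactor, h, hz.not_gt]

lemma halfFactor_neg_lower (h : detZ γ = -1) (hz : z.im < 0) :
    halfFactor φ γ z =
      Complex.I * ((KA Rm γ : ℤ) : ℂ) * ((KB (Rm * γ) : ℤ) : ℂ) * φ (γ * Rm) (-z) := by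
  simp [halfFactor, h, hz.not_gt]

end Values

lemma mact_im_neg_iff (γ : GL2Z) {z : ℂ} (hz : z.im ≠ 0) :
    (mact γ z).im < 0 ↔ (detZ γ : ℝ) * z.im < 0 := by
  rw [mact_im, div_lt_iff₀ (normSq_denom_pos γ hz), zero_mul]

lemma IsMetaplecticSection.halfFactor_mul {φ : GL2Z → ℂ → ℂ} (hφ : IsMetaplecticSection φ)
    (α β : GL2Z) {z : ℂ} (hz : z.im ≠ 0) :
    halfFactor φ α (mact β z) * halfFactor φ β z =
      ((KA α β : ℤ) : ℂ) * halfFactor φ (α * β) z := by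
  have cast {u v : ℤˣ} (h : u = v) : ((u : ℤ) : ℂ) = ((v : ℤ) : ℂ) := by rw [h]
  have hbool : boolSign true = -1 := rfl
  have hR := detZ_Rm
  have hpos := mact_im_pos_iff β hz
  have hneg := mact_im_neg_iff β hz
  rcases hz.lt_or_gt with hn | hp
  · have hn' : 0 < (-z).im := by simpa using hn
    rcases detZ_eq_one_or α with hα | hα <;> rcases detZ_eq_one_or β with hβ | hβ
    · have h := hφ.mul (α := Rm * α * Rm) (β := Rm * β * Rm) (γ := Rm * (α * β) * Rm)
        (by simp [detZ_mul, hα, hR])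
        (by simp [detZ_mul, hβ, hR]) hn' (mact_Rm_mul_mul_Rm_neg β hz)
        (by simp only [mul_assoc, Rm_mul_Rm_mul])
      have s := cast (KA_signs_pos_pos_lower (detNeg_eq_false hα) (detNeg_eq_false hβ))
      push_cast at s
      have hβz := hneg.2 (by simpa [hβ] using hn)
      rw [halfFactor_pos_lower hα hβz, halfFactor_pos_lower hβ hn,
        halfFactor_pos_lower (by rw [detZ_mul, hα, hβ]; norm_num) hn]
      linear_combination ((KB α : ℤ) : ℂ) * ((KB β : ℤ) : ℂ) * h +
        φ (Rm * (α * β) * Rm) (-z) * s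
    · have h := hφ.mul (α := α) (β := β * Rm) (γ := (α * β) * Rm)
        hα (by simp [detZ_mul, hβ, hR]) hn' (mact_mul_Rm_neg β hz)
        (by simp only [mul_assoc])
      have s := cast (KA_signs_pos_neg_lower (detNeg_eq_false hα) (detNeg_eq_true hβ))
      push_cast at s
      have hβz := hpos.2 (by simpa [hβ] using hn)
      rw [halfFactor_pos_upper hα hβz, halfFactor_neg_lower hβ hn,
        halfFactor_neg_lower (by rw [detZ_mul, hα, hβ]; norm_num) hn]
      linear_combination Complex.I * ((KA Rm β : ℤ) : ℂ) * ((KB (Rm * β) : ℤ) : ℂ) * h +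
        Complex.I * φ ((α * β) * Rm) (-z) * s
    · have h := hφ.mul (α := α * Rm) (β := Rm * β * Rm) (γ := (α * β) * Rm)
        (by simp [detZ_mul, hα, hR])
        (by simp [detZ_mul, hβ, hR]) hn' (mact_Rm_mul_mul_Rm_neg β hz)
        (by simp only [mul_assoc, Rm_mul_Rm_mul])
      have s := cast (KA_signs_neg_pos_lower (detNeg_eq_true hα) (detNeg_eq_false hβ))
      push_cast at s
      have hβz := hneg.2 (by simpa [hβ] using hn)
      rw [halfFactor_neg_lower hα hβz, halfFactor_pos_lower hβ hn,
        halfFactor_neg_lower (by rw [detZ_mul, hα, hβ]; norm_num) hn]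
      linear_combination Complex.I * ((KA Rm α : ℤ) : ℂ) * ((KB (Rm * α) : ℤ) : ℂ) *
          ((KB β : ℤ) : ℂ) * h +
        Complex.I * φ ((α * β) * Rm) (-z) * s
    · have h := hφ.mul (α := Rm * α) (β := β * Rm) (γ := Rm * (α * β) * Rm)
        (by simp [detZ_mul, hα, hR])
        (by simp [detZ_mul, hβ, hR]) hn' (mact_mul_Rm_neg β hz)
        (by simp only [mul_assoc])
      have s := cast (KA_signs_neg_neg_lower (detNeg_eq_true hα) (detNeg_eq_true hβ))
      push_cast [hbool] at s
      have hβz := hpos.2 (by simpa [hβ] using hn)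
      rw [halfFactor_neg_upper hα hβz, halfFactor_neg_lower hβ hn,
        halfFactor_pos_lower (by rw [detZ_mul, hα, hβ]; norm_num) hn]
      linear_combination Complex.I * ((KA Rm α : ℤ) : ℂ) * Complex.I * ((KA Rm β : ℤ) : ℂ) *
          ((KB (Rm * β) : ℤ) : ℂ) * h +
        φ (Rm * (α * β) * Rm) (-z) * s +
        ((KA Rm α : ℤ) : ℂ) * ((KA Rm β : ℤ) : ℂ) * ((KB (Rm * β) : ℤ) : ℂ) *
          ((KA (Rm * α) (β * Rm) : ℤ) : ℂ) * φ (Rm * (α * β) * Rm) (-z) * Complex.I_mul_I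
  · rcases detZ_eq_one_or α with hα | hα <;> rcases detZ_eq_one_or β with hβ | hβ
    · have h := hφ.mul hα hβ hp rfl rfl
      have hβz := hpos.2 (by simpa [hβ] using hp)
      rw [halfFactor_pos_upper hα hβz, halfFactor_pos_upper hβ hp,
        halfFactor_pos_upper (by rw [detZ_mul, hα, hβ]; norm_num) hp]
      exact h
    · have h := hφ.mul (α := Rm * α * Rm) (β := Rm * β) (γ := Rm * (α * β))
        (by simp [detZ_mul, hα, hR])
        (by simp [detZ_mul, hβ, hR]) hp (mact_Rm_mul β hz)
        (by simp only [mul_assoc, Rm_mul_Rm_mul])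
      have s := cast (KA_signs_pos_neg_upper (detNeg_eq_false hα) (detNeg_eq_true hβ))
      push_cast at s
      have hβz := hneg.2 (by simpa [hβ] using hp)
      rw [halfFactor_pos_lower hα hβz, halfFactor_neg_upper hβ hp,
        halfFactor_neg_upper (by rw [detZ_mul, hα, hβ]; norm_num) hp]
      linear_combination ((KB α : ℤ) : ℂ) * Complex.I * ((KA Rm β : ℤ) : ℂ) * h +
        Complex.I * φ (Rm * (α * β)) z * s
    · have h := hφ.mul (α := Rm * α) (β := β) (γ := Rm * (α * β))
        (by simp [detZ_mul, hα, hR]) hβ hp rfl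
        (by simp only [mul_assoc])
      have s := cast (KA_signs_neg_pos_upper (detNeg_eq_true hα) (detNeg_eq_false hβ))
      push_cast at s
      have hβz := hpos.2 (by simpa [hβ] using hp)
      rw [halfFactor_neg_upper hα hβz, halfFactor_pos_upper hβ hp,
        halfFactor_neg_upper (by rw [detZ_mul, hα, hβ]; norm_num) hp]
      linear_combination Complex.I * ((KA Rm α : ℤ) : ℂ) * h +
        Complex.I * φ (Rm * (α * β)) z * s
    · have h := hφ.mul (α := α * Rm) (β := Rm * β) (γ := α * β)
        (by simp [detZ_mul, hα, hR])
        (by simp [detZ_mul, hβ, hR]) hp (mact_Rm_mul β hz)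
        (by simp only [mul_assoc, Rm_mul_Rm_mul])
      have s := cast (KA_signs_neg_neg_upper (detNeg_eq_true hα) (detNeg_eq_true hβ))
      push_cast [hbool] at s
      have hβz := hneg.2 (by simpa [hβ] using hp)
      rw [halfFactor_neg_lower hα hβz, halfFactor_neg_upper hβ hp,
        halfFactor_pos_upper (by rw [detZ_mul, hα, hβ]; norm_num) hp]
      linear_combination Complex.I * ((KA Rm α : ℤ) : ℂ) * ((KB (Rm * α) : ℤ) : ℂ) * Complex.I *
          ((KA Rm β : ℤ) : ℂ) * h +
        φ (α * β) z * s +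
        ((KA Rm α : ℤ) : ℂ) * ((KB (Rm * α) : ℤ) : ℂ) * ((KA Rm β : ℤ) : ℂ) *
          ((KA (α * Rm) (Rm * β) : ℤ) : ℂ) * φ (α * β) z * Complex.I_mul_I

lemma IsMetaplecticSection.halfFactor_one {φ : GL2Z → ℂ → ℂ} (hφ : IsMetaplecticSection φ)
    {z : ℂ} (hz : z.im ≠ 0) : halfFactor φ 1 z = 1 := by
  have hA : KA 1 1 = 1 := by norm_num [KA, hilb, detZ_one, chi]
  have hB : KB 1 = 1 := by simp [KB, hilb, chi, Rm]
  have h1 {z : ℂ} (hz : 0 < z.im) : φ 1 z = 1 := by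
    have h := hφ.2.2 1 1 detZ_one detZ_one z hz
    have hsq := hφ.2.1 1 detZ_one z hz
    rw [mact_one, hA, mul_one] at h
    rw [sq, h] at hsq
    simpa using hsq
  rcases hz.lt_or_gt with hn | hp
  · simp [halfFactor, hn.not_gt, detZ_one, Rm_mul_Rm, hB, h1 (z := -z) (by simpa using hn)]
  · simp [halfFactor, hp, detZ_one, h1 hp]

lemma units_cast_ne_zero (u : ℤˣ) : ((u : ℤ) : ℂ) ≠ 0 := by exact_mod_cast u.ne_zero

/-- A metaplectic section has no zeros. -/
lemma IsMetaplecticSection.ne_zero {φ : GL2Z → ℂ → ℂ} (hφ : IsMetaplecticSection φ) {γ : GL2Z}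
    (hγ : detZ γ = 1) {z : ℂ} (hz : 0 < z.im) : φ γ z ≠ 0 := by
  intro h
  have hsq := hφ.2.1 γ hγ z hz
  rw [h] at hsq
  exact denom_ne_zero γ hz.ne' (by simpa using hsq.symm)

lemma IsMetaplecticSection.differentiableAt {φ : GL2Z → ℂ → ℂ} (hφ : IsMetaplecticSection φ)
    {γ : GL2Z} (hγ : detZ γ = 1) {z : ℂ} (hz : 0 < z.im) : DifferentiableAt ℂ (φ γ) z :=
  (hφ.1 γ hγ).differentiableAt ((isOpen_lt continuous_const Complex.continuous_im).mem_nhds hz)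

/-- On the upper half-plane the automorphy factor is a multiple of a section component. -/
lemma exists_halfFactor_upper (φ : GL2Z → ℂ → ℂ) (γ : GL2Z) :
    ∃ (c : ℂ) (γ' : GL2Z), c ≠ 0 ∧ detZ γ' = 1 ∧
      ∀ z : ℂ, 0 < z.im → halfFactor φ γ z = c * φ γ' z := by
  rcases detZ_eq_one_or γ with h | h
  · exact ⟨1, γ, one_ne_zero, h, fun z hz => by rw [halfFactor_pos_upper h hz, one_mul]⟩
  · exact ⟨Complex.I * ((KA Rm γ : ℤ) : ℂ), Rm * γ,
      mul_ne_zero Complex.I_ne_zero (units_cast_ne_zero _), by simp [detZ_mul, detZ_Rm, h],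
      fun z hz => halfFactor_neg_upper h hz⟩

/-- On the lower half-plane the automorphy factor is a multiple of a reflected section
component. -/
lemma exists_halfFactor_lower (φ : GL2Z → ℂ → ℂ) (γ : GL2Z) :
    ∃ (c : ℂ) (γ' : GL2Z), c ≠ 0 ∧ detZ γ' = 1 ∧
      ∀ z : ℂ, z.im < 0 → halfFactor φ γ z = c * φ γ' (-z) := by
  rcases detZ_eq_one_or γ with h | h
  · exact ⟨((KB γ : ℤ) : ℂ), Rm * γ * Rm, units_cast_ne_zero _,
      by simp [detZ_mul, detZ_Rm, h], fun z hz => halfFactor_pos_lower h hz⟩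
  · exact ⟨Complex.I * ((KA Rm γ : ℤ) : ℂ) * ((KB (Rm * γ) : ℤ) : ℂ), γ * Rm,
      mul_ne_zero (mul_ne_zero Complex.I_ne_zero (units_cast_ne_zero _)) (units_cast_ne_zero _),
      by simp [detZ_mul, detZ_Rm, h], fun z hz => halfFactor_neg_lower h hz⟩

lemma halfFactor_differentiableAt_and_ne_zero {φ : GL2Z → ℂ → ℂ} (hφ : IsMetaplecticSection φ)
    (γ : GL2Z) {z : ℂ} (hz : z.im ≠ 0) :
    DifferentiableAt ℂ (halfFactor φ γ) z ∧ halfFactor φ γ z ≠ 0 := by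
  rcases hz.lt_or_gt with hn | hp
  · obtain ⟨c, γ', hc, hγ', h⟩ := exists_halfFactor_lower φ γ
    have hn' : 0 < (-z).im := by simpa using hn
    refine ⟨?_, by rw [h z hn]; exact mul_ne_zero hc (hφ.ne_zero hγ' hn')⟩
    refine DifferentiableAt.congr_of_eventuallyEq (f := fun z => c * φ γ' (-z))
      (((hφ.differentiableAt hγ' hn').comp z differentiableAt_id.neg).const_mul c) ?_
    filter_upwards [(isOpen_lt Complex.continuous_im continuous_const).mem_nhds hn] with x hx
    exact h x hx
  · obtain ⟨c, γ', hc, hγ', h⟩ := exists_halfFactor_upper φ γ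
    refine ⟨?_, by rw [h z hp]; exact mul_ne_zero hc (hφ.ne_zero hγ' hp)⟩
    refine DifferentiableAt.congr_of_eventuallyEq (f := fun z => c * φ γ' z)
      ((hφ.differentiableAt hγ' hp).const_mul c) ?_
    filter_upwards [(isOpen_lt continuous_const Complex.continuous_im).mem_nhds hp] with x hx
    exact h x hx

/-- The slash rule defines a right action of `G̃` on functions on the double half-plane:
`(f|[α,ε])|[β,δ] = f|[αβ, A(α,β)·ε·δ]` and `f|[I,1] = f` on `ℍ*`, and the slash of a
holomorphic function is holomorphic. -/
theorem slash_is_action (w : ℤ) (φ : GL2Z → ℂ → ℂ) (hφ : IsMetaplecticSection φ) :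
    (∀ (f : ℂ → ℂ) (α β : GL2Z) (ε δ : ℤˣ), ∀ z ∈ Hstar,
      slash w φ (slash w φ f α ε) β δ z = slash w φ f (α * β) (KA α β * ε * δ) z) ∧
    (∀ f : ℂ → ℂ, ∀ z ∈ Hstar, slash w φ f 1 1 z = f z) ∧
    (∀ f : ℂ → ℂ, DifferentiableOn ℂ f Hstar →
      ∀ (γ : GL2Z) (ε : ℤˣ), DifferentiableOn ℂ (slash w φ f γ ε) Hstar) := by
  have hopen : IsOpen Hstar := isOpen_ne_fun Complex.continuous_im continuous_const
  refine ⟨fun f α β ε δ z hz => ?_, fun f z hz => ?_, fun f hf γ ε z hz => ?_⟩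
  · simp only [slash, slashFactor_eq, mact_mul α β hz]
    rw [mul_assoc, ← mul_zpow]
    congr 2
    push_cast
    linear_combination ((ε : ℤ) : ℂ) * ((δ : ℤ) : ℂ) * hφ.halfFactor_mul α β hz
  · simp [slash, slashFactor_eq, mact_one, hφ.halfFactor_one hz]
  · obtain ⟨hd, hne⟩ := halfFactor_differentiableAt_and_ne_zero hφ γ hz
    have hfz := hf.differentiableAt (hopen.mem_nhds (mact_im_ne_zero γ hz))
    unfold slash
    simp only [slashFactor_eq]
    exact ((hfz.comp z (differentiableAt_mact γ hz)).mul ((hd.const_mul _).zpow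
      (Or.inl (mul_ne_zero (units_cast_ne_zero ε) hne)))).differentiableWithinAt
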